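/- arXiv:1302.0803 — 4 statements merged into one kernel-verified Lean document; each statement's English description precedes it below -/
import Mathlib

section
/- Let V be a finite-dimensional real vector space with dim V = d, and let S ⊆ V be a finite set with exactly d + 2 elements whose affine span is all of V (an extended circuit). Then there exists a unique subset C ⊆ S such that the family of points of C is affinely dependent while every proper subset of C is affinely independent; i.e., every extended circuit contains a unique circuit. -/
/-- A finite circuit supports an affine relation whose coefficients are nonzero exactly on the
circuit; it can be read as a relation on any larger finite set. -/
theorem exists_affine_relation_support_eq_of_circuit {k V : Type*} [Ring k] [AddCommGroup V]
    [Module k V] {S C : Finset V} (hCS : C ⊆ S)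
    (hdep : ¬ AffineIndependent k (Subtype.val : ((C : Set V) : Type _) → V))
    (hmin : ∀ C' : Finset V, C' ⊂ C →
      AffineIndependent k (Subtype.val : ((C' : Set V) : Type _) → V)) :
    C.Nonempty ∧ ∃ f : V → k, ∑ x ∈ S, f x = 0 ∧ ∑ x ∈ S, f x • x = 0 ∧
      ∀ x, f x ≠ 0 ↔ x ∈ C := by
  classical
  obtain ⟨f, h1, h0, y, hy, hfy⟩ := exists_nontrivial_relation_sum_zero_of_not_affine_ind hdep
  refine ⟨⟨y, hy⟩, fun x => if x ∈ C then f x else 0, ?_, ?_, fun x => ?_⟩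
  · simpa [Finset.sum_ite_mem, Finset.inter_eq_right.2 hCS] using h0
  · simpa [ite_smul, Finset.sum_ite_mem, Finset.inter_eq_right.2 hCS] using h1
  · by_cases hx : x ∈ C
    · simp only [hx, if_true, iff_true]
      intro hfx
      refine hfy ((hmin _ (Finset.erase_ssubset hx)).eq_zero_of_sum_eq_zero_subtype ?_ ?_ y
        (Finset.mem_erase.2 ⟨fun h => hfy (h ▸ hfx), hy⟩))
      · rwa [Finset.sum_erase _ hfx]
      · rwa [Finset.sum_erase _ (by rw [hfx, zero_smul])]
    · simp [hx]

/-- A set of `finrank k V + 2` points that affinely spans `V` has a point whose removal leaves an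
affinely independent set. -/
theorem exists_mem_affineIndependent_erase {k V : Type*} [DivisionRing k] [AddCommGroup V]
    [Module k V] [FiniteDimensional k V] [DecidableEq V] {S : Finset V}
    (hcard : S.card = Module.finrank k V + 2) (hspan : affineSpan k (S : Set V) = ⊤) :
    ∃ p ∈ S, AffineIndependent k (Subtype.val : ((S.erase p : Finset V) : Set V) → V) := by
  obtain ⟨t, htS, ht, hind⟩ := exists_affineIndependent k V (S : Set V)
  lift t to Finset V using S.finite_toSet.subset htS
  rw [Finset.coe_subset] at htS
  have htcard : t.card = Module.finrank k V + 1 := by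
    have h := hind.affineSpan_eq_top_iff_card_eq_finrank_add_one.1
      (by rw [Subtype.range_coe, ht, hspan])
    simpa using h
  obtain ⟨p, hp⟩ : ∃ p, S \ t = {p} := by
    rw [← Finset.card_eq_one, Finset.card_sdiff_of_subset htS]
    omega
  have hpS : p ∈ S \ t := hp ▸ Finset.mem_singleton_self p
  refine ⟨p, (Finset.mem_sdiff.1 hpS).1, ?_⟩
  rwa [← Finset.sdiff_singleton_eq_erase, ← hp, Finset.sdiff_sdiff_eq_self htS]

/-- If removing `p` from `S` leaves an affinely independent set, then the support of any affine
relation on `S` is contained in the support of every nontrivial one. -/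
theorem affine_relation_support_subset {k V : Type*} [Field k] [AddCommGroup V] [Module k V]
    [DecidableEq V] {S : Finset V} {p : V}
    (hind : AffineIndependent k (Subtype.val : ((S.erase p : Finset V) : Set V) → V))
    {f g : V → k} (hf0 : ∑ x ∈ S, f x = 0) (hf1 : ∑ x ∈ S, f x • x = 0)
    (hg0 : ∑ x ∈ S, g x = 0) (hg1 : ∑ x ∈ S, g x • x = 0) {y : V} (hy : y ∈ S) (hgy : g y ≠ 0) :
    ∀ x ∈ S, f x ≠ 0 → g x ≠ 0 := by
  have key : ∀ h : V → k, ∑ x ∈ S, h x = 0 → ∑ x ∈ S, h x • x = 0 → h p = 0 →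
      ∀ x ∈ S, h x = 0 := by
    intro h h0 h1 hp x hx
    by_cases hxp : x = p
    · rwa [hxp]
    · refine hind.eq_zero_of_sum_eq_zero_subtype ?_ ?_ x (Finset.mem_erase.2 ⟨hxp, hx⟩)
      · rwa [Finset.sum_erase _ hp]
      · rwa [Finset.sum_erase _ (by rw [hp, zero_smul])]
  have hgp : g p ≠ 0 := fun hp => hgy (key g hg0 hg1 hp y hy)
  intro x hx hfx hgx
  have h := key (fun x => g p * f x - f p * g x)
    (by rw [Finset.sum_sub_distrib, ← Finset.mul_sum, ← Finset.mul_sum, hf0, hg0]; simp)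
    (by simp only [sub_smul, mul_smul]
        rw [Finset.sum_sub_distrib, ← Finset.smul_sum, ← Finset.smul_sum, hf1, hg1]; simp)
    (by ring) x hx
  simp only [hgx, mul_zero, sub_zero] at h
  exact (mul_ne_zero hgp hfx) h

/-- Every extended circuit contains a unique circuit: if `S` is a finite set of `d + 2`
points affinely spanning a `d`-dimensional real vector space `V`, then there is a unique
subset `C ⊆ S` whose points are affinely dependent while every proper subset of `C`
is affinely independent. -/
theorem extended_circuit_contains_unique_circuit
    (V : Type*) [AddCommGroup V] [Module ℝ V] [FiniteDimensional ℝ V]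
    (d : ℕ) (hd : Module.finrank ℝ V = d)
    (S : Finset V) (hcard : S.card = d + 2)
    (hspan : affineSpan ℝ (S : Set V) = ⊤) :
    ∃! C : Finset V, C ⊆ S ∧
      (¬ AffineIndependent ℝ (Subtype.val : ((C : Set V) : Type _) → V)) ∧
      (∀ C' : Finset V, C' ⊂ C →
        AffineIndependent ℝ (Subtype.val : ((C' : Set V) : Type _) → V)) := by
  classical
  obtain ⟨p, -, hp⟩ := exists_mem_affineIndependent_erase (hd ▸ hcard) hspan
  have hS : ¬ AffineIndependent ℝ (Subtype.val : ((S : Set V) : Type _) → V) := by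
    intro h
    have hle := h.card_le_finrank_succ
    have hsub := Submodule.finrank_le (vectorSpan ℝ (Set.range (Subtype.val : ((S : Set V) : Type _) → V)))
    simp only [Finset.coe_sort_coe, Fintype.card_coe] at hle
    omega
  obtain ⟨C, hCS, hC⟩ := exists_minimal_le_of_wellFoundedLT (fun C : Finset V =>
    ¬ AffineIndependent ℝ (Subtype.val : ((C : Set V) : Type _) → V)) S hS
  have hmin : ∀ C' : Finset V, C' ⊂ C →
      AffineIndependent ℝ (Subtype.val : ((C' : Set V) : Type _) → V) :=
    fun C' hC' => not_not.1 (hC.not_prop_of_lt hC')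
  refine ⟨C, ⟨hCS, hC.prop, hmin⟩, ?_⟩
  rintro D ⟨hDS, hD, hDmin⟩
  obtain ⟨⟨y, hy⟩, f, hf0, hf1, hf⟩ :=
    exists_affine_relation_support_eq_of_circuit hCS hC.prop hmin
  obtain ⟨⟨z, hz⟩, g, hg0, hg1, hg⟩ :=
    exists_affine_relation_support_eq_of_circuit hDS hD hDmin
  apply Finset.Subset.antisymm
  · intro x hx
    exact (hf x).1 (affine_relation_support_subset hp hg0 hg1 hf0 hf1 (hCS hy) ((hf y).2 hy) x
      (hDS hx) ((hg x).2 hx))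
  · intro x hx
    exact (hg x).1 (affine_relation_support_subset hp hf0 hf1 hg0 hg1 (hDS hz) ((hg z).2 hz) x
      (hCS hx) ((hf x).2 hx))
end

section
/- Let c : Fin (d + 2) → ℝ^d be an injective family of points whose affine span is all of ℝ^d, and let w : Fin (d + 2) → ℝ be a nonzero vector of coefficients with ∑ᵢ wᵢ = 0 and ∑ᵢ wᵢ • c i = 0. Then the image C = {c i | wᵢ ≠ 0} is a circuit: the family of points of C is affinely dependent, and every proper subset of C is affinely independent. -/
/-- A point with nonzero coefficient in an affine dependence lies in the affine span of the
other points. -/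
theorem mem_affineSpan_image_compl_of_sum_smul_eq_zero {k V ι : Type*} [Field k] [AddCommGroup V]
    [Module k V] [Fintype ι] {p : ι → V} {w : ι → k} (hsum : ∑ i, w i = 0)
    (hrel : ∑ i, w i • p i = 0) {j : ι} (hj : w j ≠ 0) :
    p j ∈ affineSpan k (p '' {j}ᶜ) := by
  classical
  have hsum' : ∑ i ∈ Finset.univ.erase j, w i = -w j := by
    rw [← Finset.add_sum_erase _ _ (Finset.mem_univ j)] at hsum
    exact (neg_eq_of_add_eq_zero_right hsum).symm
  have hrel' : ∑ i ∈ Finset.univ.erase j, w i • p i = -(w j • p j) := by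
    rw [← Finset.add_sum_erase _ _ (Finset.mem_univ j)] at hrel
    exact (neg_eq_of_add_eq_zero_right hrel).symm
  have hone : ∑ i ∈ Finset.univ.erase j, (-(w j)⁻¹ * w i) = 1 := by
    rw [← Finset.mul_sum, hsum']
    field_simp
  have hcomb : (Finset.univ.erase j).affineCombination k p (fun i => -(w j)⁻¹ * w i) = p j := by
    rw [Finset.affineCombination_eq_linear_combination _ _ _ hone]
    simp only [mul_smul]
    rw [← Finset.smul_sum, hrel', smul_neg, neg_smul, neg_neg, inv_smul_smul₀ hj]
  rw [← hcomb]
  refine affineCombination_mem_affineSpan_image hone (fun i hi hi' => ?_) p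
  simp at hi hi'
  exact absurd hi' hi

/-- Removing a point with nonzero coefficient in an affine dependence from `finrank + 2` points
spanning the whole space leaves an affinely independent family. -/
theorem affineIndependent_ne_of_sum_smul_eq_zero {k V ι : Type*} [Field k] [AddCommGroup V]
    [Module k V] [FiniteDimensional k V] [Fintype ι] {p : ι → V}
    (hcard : Fintype.card ι = Module.finrank k V + 2) (hspan : affineSpan k (Set.range p) = ⊤)
    {w : ι → k} (hsum : ∑ i, w i = 0) (hrel : ∑ i, w i • p i = 0) {j : ι} (hj : w j ≠ 0) :
    AffineIndependent k (fun i : {i // i ≠ j} => p i) := by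
  classical
  have hrange : Set.range (fun i : {i // i ≠ j} => p i) = p '' {j}ᶜ := by
    ext x
    simp
  have hinsert : Set.range p = insert (p j) (p '' {j}ᶜ) := by
    rw [← Set.image_insert_eq, ← Set.image_univ]
    congr 1
    ext i
    simp [em]
  have htop : affineSpan k (p '' {j}ᶜ) = ⊤ := by
    rw [← hspan, hinsert, affineSpan_insert_eq_affineSpan k
      (mem_affineSpan_image_compl_of_sum_smul_eq_zero hsum hrel hj)]
  have hcard' : Fintype.card {i // i ≠ j} = Module.finrank k V + 1 := by
    rw [Fintype.card_subtype_compl, hcard, Fintype.card_subtype_eq]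
    rfl
  rw [affineIndependent_iff_finrank_vectorSpan_eq k _ hcard', hrange, ← direction_affineSpan, htop,
    AffineSubspace.direction_top, finrank_top]

/-- The support of an affine dependence relation of an extended circuit is a circuit:
if `c : Fin (d + 2) → ℝ^d` is injective and affinely spans `ℝ^d`, and `w ≠ 0` satisfies
`∑ i, w i = 0` and `∑ i, w i • c i = 0`, then `C = c '' {i | w i ≠ 0}` is affinely
dependent while every proper subset of `C` is affinely independent. -/
theorem support_of_dependence_is_circuit
    (d : ℕ) (c : Fin (d + 2) → (Fin d → ℝ)) (hinj : Function.Injective c)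
    (hspan : affineSpan ℝ (Set.range c) = ⊤)
    (w : Fin (d + 2) → ℝ) (hw : w ≠ 0) (hsum : ∑ i, w i = 0)
    (hrel : ∑ i, w i • c i = 0) :
    (¬ AffineIndependent ℝ ((↑) : (c '' {i | w i ≠ 0}) → (Fin d → ℝ))) ∧
    (∀ C' : Set (Fin d → ℝ), C' ⊂ c '' {i | w i ≠ 0} →
      AffineIndependent ℝ ((↑) : C' → (Fin d → ℝ))) := by
  constructor
  · intro h
    let f : {i // w i ≠ 0} ↪ (c '' {i | w i ≠ 0} : Set (Fin d → ℝ)) :=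
      ⟨fun i => ⟨c i, i, i.2, rfl⟩,
        fun _ _ hab => Subtype.ext (hinj (congrArg Subtype.val hab))⟩
    have hs : AffineIndependent ℝ (fun i : {i // w i ≠ 0} => c i) := h.comp_embedding f
    have hmem : ∀ i, i ∈ Finset.univ.filter (fun i => w i ≠ 0) ↔ w i ≠ 0 := by simp
    obtain ⟨j, hj⟩ := Function.ne_iff.mp hw
    refine hj (affineIndependent_iff.mp hs Finset.univ (fun i => w i) ?_ ?_ ⟨j, hj⟩
      (Finset.mem_univ _))
    · rw [← Finset.sum_subtype _ hmem w, Finset.sum_filter_ne_zero, hsum]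
    · rw [← Finset.sum_subtype _ hmem (fun i => w i • c i), Finset.sum_filter_of_ne, hrel]
      exact fun i _ hi h0 => hi (by simp [h0])
  · intro C' hC'
    obtain ⟨_, ⟨j, hj, rfl⟩, hjC'⟩ := Set.exists_of_ssubset hC'
    have hind := (affineIndependent_ne_of_sum_smul_eq_zero (by simp) hspan hsum hrel hj).range
    refine hind.mono fun x hx => ?_
    obtain ⟨i, -, rfl⟩ := hC'.subset hx
    exact ⟨⟨i, fun hij => hjC' (hij ▸ hx)⟩, rfl⟩
end

section
/- Let K ⊆ ℝⁿ be a closed convex cone with K ∩ (−K) ⊆ {0} (strongly convex), let C ⊆ K be a convex cone with nonempty interior, and let χ ∈ K with χ ≠ 0. Then the set U = {u ∈ ℝⁿ | u ∉ K and there exists t > 0 with χ + t • u ∈ interior C} is open and nonempty. -/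
open scoped Pointwise in
/-- If scaling by `s > 0` maps a set into itself, it maps its interior into itself. -/
theorem smul_mem_interior_of_smul_mem {E : Type*} [TopologicalSpace E] [AddCommGroup E]
    [Module ℝ E] [ContinuousConstSMul ℝ E] {C : Set E} {s : ℝ} (hs : 0 < s)
    (hC : ∀ a ∈ C, s • a ∈ C) {x : E} (hx : x ∈ interior C) : s • x ∈ interior C := by
  have hsub : s • C ⊆ C := by
    rintro _ ⟨a, ha, rfl⟩
    exact hC a ha
  apply interior_mono hsub
  rw [interior_smul₀ hs.ne']
  exact Set.smul_mem_smul_set hx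

/-- Let `K ⊆ ℝⁿ` be a closed strongly convex cone, `C ⊆ K` a convex cone with nonempty
interior, and `χ ∈ K` nonzero. Then the set of directions `u ∉ K` such that the ray
`χ + t • u` hits the interior of `C` for some `t > 0` is open and nonempty. -/
theorem good_directions_open_nonempty
    (n : ℕ) (K C : Set (Fin n → ℝ)) (hKclosed : IsClosed K)
    (hKadd : ∀ a ∈ K, ∀ b ∈ K, a + b ∈ K)
    (hKsmul : ∀ c : ℝ, 0 ≤ c → ∀ a ∈ K, c • a ∈ K)
    (hpointed : K ∩ (-K) ⊆ {0})
    (hCK : C ⊆ K)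
    (hCadd : ∀ a ∈ C, ∀ b ∈ C, a + b ∈ C)
    (hCsmul : ∀ c : ℝ, 0 ≤ c → ∀ a ∈ C, c • a ∈ C)
    (hCint : (interior C).Nonempty)
    (χ : Fin n → ℝ) (hχ : χ ∈ K) (hχ0 : χ ≠ 0) :
    IsOpen {u : Fin n → ℝ | u ∉ K ∧ ∃ t : ℝ, 0 < t ∧ χ + t • u ∈ interior C} ∧
    {u : Fin n → ℝ | u ∉ K ∧ ∃ t : ℝ, 0 < t ∧ χ + t • u ∈ interior C}.Nonempty := by
  have interior_smul_mem : ∀ s : ℝ, 0 < s → ∀ x ∈ interior C, s • x ∈ interior C :=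
    fun s hs _ hx => smul_mem_interior_of_smul_mem hs (hCsmul s hs.le) hx
  constructor
  · refine hKclosed.isOpen_compl.inter ?_
    have hunion : {u : Fin n → ℝ | ∃ t : ℝ, 0 < t ∧ χ + t • u ∈ interior C} =
        ⋃ t ∈ Set.Ioi (0 : ℝ), (fun u => χ + t • u) ⁻¹' interior C := by
      ext u
      simp
    change IsOpen {u : Fin n → ℝ | ∃ t : ℝ, 0 < t ∧ χ + t • u ∈ interior C}
    rw [hunion]
    exact isOpen_biUnion fun t _ => isOpen_interior.preimage (by fun_prop)
  · obtain ⟨c, hc⟩ := hCint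
    have hneg : -χ ∈ Kᶜ := fun h => hχ0 (hpointed ⟨hχ, h⟩)
    have hcont : Continuous fun s : ℝ => s • c - χ := by fun_prop
    have hnear : ∀ᶠ s : ℝ in nhds 0, s • c - χ ∈ Kᶜ :=
      hcont.continuousAt.eventually_mem (hKclosed.isOpen_compl.mem_nhds (by simpa using hneg))
    obtain ⟨s, hsK, hs⟩ :=
      ((hnear.filter_mono nhdsWithin_le_nhds).and
        (self_mem_nhdsWithin : Set.Ioi (0 : ℝ) ∈ nhdsWithin 0 (Set.Ioi 0))).exists
    exact ⟨s • c - χ, hsK, 1, one_pos, by simpa using interior_smul_mem s hs c hc⟩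
end

section
/- Let K ⊆ ℝⁿ be a closed convex cone with K ∩ (−K) ⊆ {0} (strongly convex), let C ⊆ K be a convex cone with nonempty interior, let χ ∈ K with χ ≠ 0, and let S₁, …, S_r ⊆ ℝⁿ be finitely many sets such that each S_j is contained in some linear subspace of ℝⁿ of dimension at most n − 2. Then there exists a direction u ∈ ℝⁿ such that: (a) χ + t₀ • u lies in the interior of C for some t₀ > 0; (b) the set {t ∈ ℝ | 0 ≤ t and χ + t • u ∈ K} is bounded; and (c) for every t > 0 and every j, χ + t • u ∉ S_j. -/
open MeasureTheory in
/-- A nonempty open set is not covered by finitely many proper linear subspaces. -/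
theorem IsOpen.exists_mem_forall_notMem_submodule {n : ℕ} {ι : Type*} [Finite ι]
    {U : Set (Fin n → ℝ)} (hU : IsOpen U) (hne : U.Nonempty)
    (V : ι → Submodule ℝ (Fin n → ℝ)) (hV : ∀ j, V j ≠ ⊤) :
    ∃ p ∈ U, ∀ j, p ∉ V j := by
  by_contra! h
  have hnull : volume (⋃ j, (V j : Set (Fin n → ℝ))) = 0 :=
    measure_iUnion_null fun j => Measure.addHaar_submodule _ _ (hV j)
  refine (hU.measure_pos volume hne).ne' (measure_mono_null (fun p hp => ?_) hnull)
  simpa using h p hp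

open Filter Topology in
/-- A ray whose direction is not in the closed cone `K` meets `K` for a bounded set of times. -/
theorem bddAbove_ray_inter_of_notMem {E : Type*} [AddCommGroup E] [Module ℝ E]
    [TopologicalSpace E] [ContinuousAdd E] [ContinuousSMul ℝ E] {K : Set E} (hK : IsClosed K)
    (hKsmul : ∀ c : ℝ, 0 ≤ c → ∀ a ∈ K, c • a ∈ K) (x : E) {u : E} (hu : u ∉ K) :
    BddAbove {t : ℝ | 0 ≤ t ∧ x + t • u ∈ K} := by
  have hlim : Tendsto (fun t : ℝ => t⁻¹ • x + u) atTop (𝓝 u) := by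
    simpa using ((tendsto_inv_atTop_zero (𝕜 := ℝ)).smul_const x).add_const u
  obtain ⟨T, hT⟩ := eventually_atTop.1
    ((hlim.eventually (hK.isOpen_compl.mem_nhds hu)).and (eventually_gt_atTop 0))
  refine ⟨T, fun t ⟨ht, hmem⟩ => ?_⟩
  by_contra! hlt
  obtain ⟨hnot, hpos⟩ := hT t hlt.le
  refine hnot ?_
  have := hKsmul t⁻¹ (inv_nonneg.2 ht) _ hmem
  rwa [smul_add, inv_smul_smul₀ hpos.ne'] at this

open Pointwise in
/-- The interior of a cone is stable under multiplication by positive reals. -/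
theorem smul_mem_interior_of_cone {E : Type*} [AddCommGroup E] [Module ℝ E]
    [TopologicalSpace E] [ContinuousConstSMul ℝ E] {C : Set E}
    (hC : ∀ c : ℝ, 0 ≤ c → ∀ a ∈ C, c • a ∈ C) {s : ℝ} (hs : 0 < s) {x : E}
    (hx : x ∈ interior C) : s • x ∈ interior C := by
  have hsub : s • C ⊆ C := Set.smul_set_subset_iff.2 fun a ha => hC s hs.le a ha
  refine interior_mono hsub ?_
  rw [interior_smul₀ hs.ne']
  exact Set.smul_mem_smul_set hx


/-- Any phase can be reached by a straight line run (convex-geometric content):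
given a closed strongly convex cone `K ⊆ ℝⁿ`, a convex cone `C ⊆ K` with nonempty
interior, a nonzero `χ ∈ K`, and finitely many sets `S j` each contained in a linear
subspace of dimension at most `n - 2`, there is a direction `u` such that the ray from
`χ` in direction `u` hits the interior of `C`, stays in `K` only for a bounded set of
times, and avoids every `S j`. -/
theorem straight_line_run_exists
    (n r : ℕ) (K C : Set (Fin n → ℝ)) (hKclosed : IsClosed K)
    (hKadd : ∀ a ∈ K, ∀ b ∈ K, a + b ∈ K)
    (hKsmul : ∀ c : ℝ, 0 ≤ c → ∀ a ∈ K, c • a ∈ K)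
    (hpointed : K ∩ (-K) ⊆ {0})
    (hCK : C ⊆ K)
    (hCadd : ∀ a ∈ C, ∀ b ∈ C, a + b ∈ C)
    (hCsmul : ∀ c : ℝ, 0 ≤ c → ∀ a ∈ C, c • a ∈ C)
    (hCint : (interior C).Nonempty)
    (χ : Fin n → ℝ) (hχ : χ ∈ K) (hχ0 : χ ≠ 0)
    (S : Fin r → Set (Fin n → ℝ))
    (hS : ∀ j, ∃ W : Submodule ℝ (Fin n → ℝ),
      (Module.finrank ℝ W : ℤ) ≤ (n : ℤ) - 2 ∧ S j ⊆ (W : Set (Fin n → ℝ))) :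
    ∃ u : Fin n → ℝ,
      (∃ t₀ : ℝ, 0 < t₀ ∧ χ + t₀ • u ∈ interior C) ∧
      BddAbove {t : ℝ | 0 ≤ t ∧ χ + t • u ∈ K} ∧
      (∀ t : ℝ, 0 < t → ∀ j, χ + t • u ∉ S j) := by
  obtain ⟨c, hc⟩ := hCint
  choose W hWdim hWS using hS
  have hneg : -χ ∉ K := fun h => hχ0 (hpointed ⟨hχ, h⟩)
  have hlim : Filter.Tendsto (fun s : ℝ => s • c - χ) (nhdsWithin 0 (Set.Ioi 0))
      (nhds (-χ)) := by
    have hcont : Continuous fun s : ℝ => s • c - χ := by fun_prop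
    simpa using (hcont.tendsto 0).mono_left nhdsWithin_le_nhds
  obtain ⟨s, hsK, hs⟩ := ((hlim.eventually (hKclosed.isOpen_compl.mem_nhds hneg)).and
    self_mem_nhdsWithin).exists
  have hopen : IsOpen (interior C ∩ (fun p => p - χ) ⁻¹' Kᶜ) :=
    isOpen_interior.inter (hKclosed.isOpen_compl.preimage (by fun_prop))
  have hproper : ∀ j, W j ⊔ Submodule.span ℝ {χ} ≠ ⊤ := by
    intro j htop
    have hle := Submodule.finrank_add_le_finrank_add_finrank (W j) (Submodule.span ℝ {χ})
    rw [htop, finrank_top, Module.finrank_fin_fun, finrank_span_singleton hχ0] at hle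
    have := hWdim j
    omega
  obtain ⟨p, ⟨hpC, hpK⟩, hpW⟩ := hopen.exists_mem_forall_notMem_submodule
    ⟨s • c, smul_mem_interior_of_cone hCsmul hs hc, hsK⟩ _ hproper
  refine ⟨p - χ, ⟨1, one_pos, by simpa using hpC⟩,
    bddAbove_ray_inter_of_notMem hKclosed hKsmul χ hpK, fun t ht j hmem => hpW j ?_⟩
  have hp : p = t⁻¹ • ((χ + t • (p - χ)) + (t - 1) • χ) := by
    rw [eq_inv_smul_iff₀ ht.ne']
    module
  rw [hp]
  exact Submodule.smul_mem _ _ (Submodule.add_mem_sup (hWS j hmem)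
    (Submodule.smul_mem _ _ (Submodule.mem_span_singleton_self χ)))
end
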